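/- Let f₁, f₂ be Schwartz functions on ℝ^{2n} and ℏ > 0. Then the two integral representations of the Weyl star product agree: (πℏ)^{-2n} ∫∫_{ℝ^{2n}×ℝ^{2n}} f₁(x₁) f₂(x₂) e^{iP₃(x₁,x₂,x)/ℏ} dx₁ dx₂ = (2πℏ)^{-2n} ∫∫_{ℝ^{2n}×ℝ^{2n}} f₁(x - (1/2)Jy) f₂(x') e^{i y·(x - x')/ℏ} dy dx', for every x ∈ ℝ^{2n} (both integrands being absolutely integrable). -/

import Mathlib

open Matrix MeasureTheory

noncomputable section

abbrev Vec (n : ℕ) := Fin (2*n) → ℝ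

/-- The `2n×2n` symplectic matrix `J = [[0, Iₙ], [-Iₙ, 0]]`. -/
def symJ (n : ℕ) : Matrix (Fin (2*n)) (Fin (2*n)) ℝ :=
  Matrix.of fun i j =>
    if i.val < n ∧ j.val = i.val + n then 1
    else if j.val < n ∧ i.val = j.val + n then -1 else 0

/-- Gradient of a scalar function on `ℝ^m`, as the vector of partial derivatives. -/
def grad {m : ℕ} (f : (Fin m → ℝ) → ℝ) (x : Fin m → ℝ) : Fin m → ℝ :=
  fun i => fderiv ℝ f x (Pi.single i 1)

/-- Primary Poisson bracket `{f,g}₁(x) = ∇f(x) · J ∇g(x)`. -/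
def pb1 (n : ℕ) (f g : Vec n → ℝ) (x : Vec n) : ℝ :=
  grad f x ⬝ᵥ (symJ n).mulVec (grad g x)

/-- `x`-gradient of a function on secondary phase space `ℝ^{2n} × ℝ^{2n}`. -/
def grad2x (n : ℕ) (F : Vec n × Vec n → ℝ) (z : Vec n × Vec n) : Vec n :=
  fun i => fderiv ℝ F z (Pi.single i 1, 0)

/-- `y`-gradient of a function on secondary phase space `ℝ^{2n} × ℝ^{2n}`. -/
def grad2y (n : ℕ) (F : Vec n × Vec n → ℝ) (z : Vec n × Vec n) : Vec n :=
  fun i => fderiv ℝ F z (0, Pi.single i 1)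

/-- Secondary Poisson bracket `{F,G}₂(z) = ∇F(z) · J̃ ∇G(z)` with
`J̃ = [[0, I_{2n}], [-I_{2n}, 0]]`, i.e. `∇ₓF·∇_yG - ∇_yF·∇ₓG`. -/
def pb2 (n : ℕ) (F G : Vec n × Vec n → ℝ) (z : Vec n × Vec n) : ℝ :=
  grad2x n F z ⬝ᵥ grad2y n G z - grad2y n F z ⬝ᵥ grad2x n G z

/-- Left projection `l(x,y) = x - (1/2) J y`. -/
def lmap (n : ℕ) (z : Vec n × Vec n) : Vec n := z.1 - (1/2 : ℝ) • (symJ n).mulVec z.2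

/-- Right projection `r(x,y) = x + (1/2) J y`. -/
def rmap (n : ℕ) (z : Vec n × Vec n) : Vec n := z.1 + (1/2 : ℝ) • (symJ n).mulVec z.2

/-- Hessian matrix of a scalar function on `ℝ^m`. -/
def hess {m : ℕ} (f : (Fin m → ℝ) → ℝ) (x : Fin m → ℝ) : Matrix (Fin m) (Fin m) ℝ :=
  Matrix.of fun i j => fderiv ℝ (fun y => fderiv ℝ f y (Pi.single j 1)) x (Pi.single i 1)

/-- Jacobian matrix of a map `ℝ^m → ℝ^m`. -/
def jac {m : ℕ} (f : (Fin m → ℝ) → (Fin m → ℝ)) (x : Fin m → ℝ) :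
    Matrix (Fin m) (Fin m) ℝ :=
  Matrix.of fun i j => fderiv ℝ f x (Pi.single j 1) i

/-- Operator norm of a matrix acting on Euclidean space `ℝ^m`. -/
def opNorm {m : ℕ} (A : Matrix (Fin m) (Fin m) ℝ) : ℝ :=
  ‖Matrix.toEuclideanCLM (𝕜 := ℝ) A‖

/-- Symplectic pairing `x ∧ y = x · J y`. -/
def wedgeP (n : ℕ) (x y : Vec n) : ℝ := x ⬝ᵥ (symJ n).mulVec y

/-- The triangle phase `P₃(x₁,x₂,x₃) = 2(x₁∧x₂ - x₁∧x₃ + x₂∧x₃)`. -/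
def P3 (n : ℕ) (x₁ x₂ x₃ : Vec n) : ℝ :=
  2 * (wedgeP n x₁ x₂ - wedgeP n x₁ x₃ + wedgeP n x₂ x₃)

lemma symJ_transpose (n : ℕ) : (symJ n)ᵀ = - symJ n := by
  ext i j
  simp only [symJ, Matrix.transpose_apply, Matrix.of_apply, Matrix.neg_apply]
  split_ifs <;> first | omega | simp

lemma symJ_mul_self (n : ℕ) : symJ n * symJ n = -1 := by
  ext i j
  have hi := i.isLt
  by_cases h : i.val < n
  · have hk : i.val + n < 2 * n := by omega
    rw [Matrix.mul_apply, Finset.sum_eq_single (⟨i.val + n, hk⟩ : Fin (2*n))]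
    · by_cases hij : i = j
      · subst hij
        simp [symJ, h]
      · have : i.val ≠ j.val := fun e => hij (Fin.ext e)
        simp [symJ, h, hij]
        intros; omega
    · intro b _ hb
      have : b.val ≠ i.val + n := fun e => hb (Fin.ext e)
      have hz : symJ n i b = 0 := by
        simp only [symJ, Matrix.of_apply]
        split_ifs <;> first | omega | rfl
      rw [hz, zero_mul]
    · simp
  · have hk : i.val - n < 2 * n := by omega
    rw [Matrix.mul_apply, Finset.sum_eq_single (⟨i.val - n, hk⟩ : Fin (2*n))]
    · by_cases hij : i = j
      · subst hij
        simp [symJ, h]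
        split_ifs <;> first | omega | simp
      · have : i.val ≠ j.val := fun e => hij (Fin.ext e)
        simp [symJ, h, hij]
        intros
        split_ifs <;> first | omega | simp
    · intro b _ hb
      have : b.val ≠ i.val - n := fun e => hb (Fin.ext e)
      have hz : symJ n i b = 0 := by
        simp only [symJ, Matrix.of_apply]
        split_ifs <;> first | omega | rfl
      rw [hz, zero_mul]
    · simp

lemma symJ_det_sq (n : ℕ) : (symJ n).det * (symJ n).det = 1 := by
  rw [← Matrix.det_mul, symJ_mul_self, Matrix.det_neg]
  simp

lemma symJ_abs_det (n : ℕ) : |(symJ n).det| = 1 := by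
  have h := symJ_det_sq n
  rcases mul_self_eq_one_iff.mp h with h | h <;> simp [h]

lemma wedgeP_swap (n : ℕ) (a b : Vec n) : wedgeP n a b = - wedgeP n b a := by
  unfold wedgeP
  rw [Matrix.dotProduct_mulVec, ← Matrix.mulVec_transpose, symJ_transpose,
    Matrix.neg_mulVec, neg_dotProduct, dotProduct_comm]

lemma wedgeP_self (n : ℕ) (a : Vec n) : wedgeP n a a = 0 := by
  have := wedgeP_swap n a a
  linarith

lemma phase_eq (n : ℕ) (x y x' : Vec n) :
    P3 n (x - (1/2 : ℝ) • (symJ n).mulVec y) x' x = y ⬝ᵥ (x - x') := by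
  have key : ∀ a : Vec n, wedgeP n a ((symJ n).mulVec y) = - (y ⬝ᵥ a) := by
    intro a
    unfold wedgeP
    rw [Matrix.mulVec_mulVec, symJ_mul_self, Matrix.neg_mulVec, Matrix.one_mulVec,
      dotProduct_neg, dotProduct_comm]
  have sub : ∀ a b c : Vec n, wedgeP n (a - (1/2:ℝ) • b) c
      = wedgeP n a c - (1/2) * wedgeP n b c := by
    intro a b c
    simp [wedgeP, sub_dotProduct, smul_dotProduct]
  unfold P3
  rw [sub, sub, wedgeP_self, wedgeP_swap n x' x, wedgeP_swap n (symJ n *ᵥ y) x',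
    wedgeP_swap n (symJ n *ᵥ y) x, key, key, dotProduct_sub]
  ring

lemma map_vol_aux (n : ℕ) (x : Vec n) :
    Measure.map (fun y : Vec n => x - (1/2 : ℝ) • (symJ n).mulVec y) volume
      = ENNReal.ofReal (2 ^ (2*n)) • volume := by
  set M : Matrix (Fin (2*n)) (Fin (2*n)) ℝ := (-(1/2) : ℝ) • symJ n with hM
  have habs : |M.det| = (1/2) ^ (2*n) := by
    rw [hM, Matrix.det_smul, abs_mul, symJ_abs_det, abs_pow]
    simp
  have hdet : M.det ≠ 0 := by
    intro h0
    rw [h0, abs_zero] at habs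
    have : (0:ℝ) < (1/2) ^ (2*n) := by positivity
    linarith
  have hfun : (fun y : Vec n => x - (1/2 : ℝ) • (symJ n).mulVec y)
      = (fun z => x + z) ∘ (Matrix.toLin' M) := by
    funext y
    simp [hM, Matrix.smul_mulVec, sub_eq_add_neg]
  have hcont : Continuous (Matrix.toLin' M) := LinearMap.continuous_of_finiteDimensional _
  rw [hfun, ← Measure.map_map (measurable_const_add x) hcont.measurable,
    Real.map_matrix_volume_pi_eq_smul_volume_pi hdet, Measure.map_smul, map_add_left_eq_self,
    abs_inv, habs]
  congr 2
  simp

lemma map_vol_prod (n : ℕ) (x : Vec n) :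
    Measure.map (fun p : Vec n × Vec n => (x - (1/2 : ℝ) • (symJ n).mulVec p.1, p.2)) volume
      = ENNReal.ofReal (2 ^ (2*n)) • volume := by
  have hm : Measurable (fun y : Vec n => x - (1/2 : ℝ) • (symJ n).mulVec y) := by
    apply Continuous.measurable
    fun_prop
  have h := Measure.map_prod_map (volume : Measure (Vec n)) (volume : Measure (Vec n))
    hm measurable_id
  rw [map_vol_aux, Measure.map_id, Measure.prod_smul_left] at h
  exact h.symm

lemma emb_prod (n : ℕ) (x : Vec n) :
    MeasurableEmbedding
      (fun p : Vec n × Vec n => (x - (1/2 : ℝ) • (symJ n).mulVec p.1, p.2)) := by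
  apply Continuous.measurableEmbedding
  · fun_prop
  · rintro ⟨a, b⟩ ⟨c, d⟩ h
    simp only [Prod.mk.injEq, sub_right_inj] at h
    obtain ⟨h1, h2⟩ := h
    have h3 : (symJ n).mulVec a = (symJ n).mulVec c :=
      smul_right_injective _ (by norm_num : (1/2 : ℝ) ≠ 0) h1
    have h4 := congrArg (symJ n).mulVec h3
    simp only [Matrix.mulVec_mulVec, symJ_mul_self, Matrix.neg_mulVec, Matrix.one_mulVec,
      neg_inj] at h4
    rw [h4, h2]

/-- for Schwartz functions `f₁, f₂` on `ℝ^{2n}` and `ℏ > 0`, the two integral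
representations of the Weyl star product agree:
`(πℏ)^{-2n} ∫∫ f₁(x₁)f₂(x₂) e^{iP₃(x₁,x₂,x)/ℏ} dx₁dx₂
  = (2πℏ)^{-2n} ∫∫ f₁(x - (1/2)Jy) f₂(x') e^{i y·(x-x')/ℏ} dy dx'`. -/
theorem stmt18 (n : ℕ) (ℏ : ℝ) (hℏ : 0 < ℏ)
    (f₁ f₂ : SchwartzMap (Vec n) ℝ) (x : Vec n) :
    (((Real.pi * ℏ) ^ (2*n))⁻¹ : ℝ) •
      (∫ p : Vec n × Vec n,
        (f₁ p.1 : ℂ) * (f₂ p.2 : ℂ) * Complex.exp (Complex.I * (P3 n p.1 p.2 x : ℂ) / (ℏ : ℂ)))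
    = (((2 * Real.pi * ℏ) ^ (2*n))⁻¹ : ℝ) •
      (∫ p : Vec n × Vec n,
        (f₁ (x - (1/2 : ℝ) • (symJ n).mulVec p.1) : ℂ) * (f₂ p.2 : ℂ) *
          Complex.exp (Complex.I * ((p.1 ⬝ᵥ (x - p.2) : ℝ) : ℂ) / (ℏ : ℂ))) := by
  have h := (emb_prod n x).integral_map (μ := volume) (fun p : Vec n × Vec n =>
        (f₁ p.1 : ℂ) * (f₂ p.2 : ℂ) * Complex.exp (Complex.I * (P3 n p.1 p.2 x : ℂ) / (ℏ : ℂ)))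
  rw [map_vol_prod, integral_smul_measure, ENNReal.toReal_ofReal (by positivity)] at h
  simp only [phase_eq] at h
  rw [← h, smul_smul]
  congr 1
  have := Real.pi_pos
  rw [mul_assoc 2, mul_pow 2]
  field_simp
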